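/- Let n = 2^m, 0 ≤ i ≤ n−1, u_{2i} ∈ F_2^{2i+1} and u_{2i+1} ∈ F_2, and write u_{2i−1} for the first 2i entries of u_{2i}. Then the weight enumerating functions of polar cosets satisfy A_{2n}^{(2i+1)}(u_{2i}, u_{2i+1})(X) = A_n^{(i)}(u_{2i−1,even} ⊕ u_{2i−1,odd}, u_{2i} ⊕ u_{2i+1})(X) · A_n^{(i)}(u_{2i−1,odd}, u_{2i+1})(X), where u_{2i} in the second argument of the first factor denotes the last entry of the prefix u_{2i}. -/

import Mathlib

open Matrix

/-- The 2×2 polar kernel over F₂. -/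
def K2 : Matrix (Fin 2) (Fin 2) (ZMod 2) := !![1, 0; 1, 1]

/-- The `m`-fold Kronecker power of `K2`, rows and columns indexed by
binary expansions (bit `k` of the index corresponds to the `k`-th factor). -/
def kronPow (m : ℕ) : Matrix (Fin (2 ^ m)) (Fin (2 ^ m)) (ZMod 2) :=
  Matrix.of fun i j => ∏ k ∈ Finset.range m,
    K2 ⟨i.val / 2 ^ k % 2, Nat.mod_lt _ (by norm_num)⟩
       ⟨j.val / 2 ^ k % 2, Nat.mod_lt _ (by norm_num)⟩

/-- Reversal of the `m`-bit binary expansion of `i`. -/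
def bitrev (m i : ℕ) : ℕ := ∑ k ∈ Finset.range m, (i / 2 ^ k % 2) * 2 ^ (m - 1 - k)

/-- The `2^m × 2^m` bit-reversal permutation matrix. -/
def Bmat (m : ℕ) : Matrix (Fin (2 ^ m)) (Fin (2 ^ m)) (ZMod 2) :=
  Matrix.of fun i j => if (j : ℕ) = bitrev m i.val then 1 else 0

/-- The polar transformation matrix `G_n = B_n K_2^{⊗ m}`, `n = 2^m`. -/
def Gmat (m : ℕ) : Matrix (Fin (2 ^ m)) (Fin (2 ^ m)) (ZMod 2) := Bmat m * kronPow m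

/-- Assembling the vector `(u_{i-1}, u_i, u')` out of a prefix `p` of length `i`,
a bit `b`, and a suffix `s` of length `n - 1 - i`. -/
def assemble {n : ℕ} (i : ℕ) (p : Fin i → ZMod 2) (b : ZMod 2)
    (s : Fin (n - 1 - i) → ZMod 2) : Fin n → ZMod 2 :=
  fun j =>
    if h : (j : ℕ) < i then p ⟨j, h⟩
    else if h2 : (j : ℕ) = i then b
    else s ⟨(j : ℕ) - i - 1, by have h3 := j.isLt; omega⟩

/-- The polar coset `C_n^{(i)}(u_{i-1}, u_i)`, `n = 2^m`. -/
def polarCoset (m i : ℕ) (p : Fin i → ZMod 2) (b : ZMod 2) :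
    Set (Fin (2 ^ m) → ZMod 2) :=
  { c | ∃ s : Fin (2 ^ m - 1 - i) → ZMod 2, c = (assemble i p b s) ᵥ* Gmat m }

/-- Even-index subvector. -/
def evPart {i : ℕ} (p : Fin (2 * i) → ZMod 2) : Fin i → ZMod 2 :=
  fun k => p ⟨2 * k.val, by have := k.isLt; omega⟩

/-- Odd-index subvector. -/
def odPart {i : ℕ} (p : Fin (2 * i) → ZMod 2) : Fin i → ZMod 2 :=
  fun k => p ⟨2 * k.val + 1, by have := k.isLt; omega⟩

/-- Concatenation of two length-`2^m` vectors into a length-`2^(m+1)` vector. -/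
def concatPow {m : ℕ} (a b : Fin (2 ^ m) → ZMod 2) : Fin (2 ^ (m + 1)) → ZMod 2 :=
  fun j =>
    if h : (j : ℕ) < 2 ^ m then a ⟨j, h⟩
    else b ⟨(j : ℕ) - 2 ^ m, by
      have h1 := j.isLt
      have h2 : (2 : ℕ) ^ (m + 1) = 2 ^ m * 2 := pow_succ 2 m
      have h3 : 1 ≤ (2 : ℕ) ^ m := Nat.one_le_two_pow
      omega⟩

/-- The weight enumerating function `A_n^{(i)}(u_{i-1}, u_i)(X)` of a polar coset. -/
noncomputable def cosetWEF (m i : ℕ) (p : Fin i → ZMod 2) (b : ZMod 2) : Polynomial ℕ :=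
  ∑ c ∈ (polarCoset m i p b).toFinite.toFinset, Polynomial.X ^ hammingNorm c

/-- The first `2i` entries of a prefix of length `2i + 1`. -/
def initPart {i : ℕ} (p : Fin (2 * i + 1) → ZMod 2) : Fin (2 * i) → ZMod 2 :=
  fun k => p ⟨k.val, by have := k.isLt; omega⟩

theorem sum_fin_two_pow_succ {M : Type*} [AddCommMonoid M] (m : ℕ) (F : Fin (2 ^ (m + 1)) → M) :
    ∑ j, F j = ∑ a : Fin (2 ^ m),
      (F ⟨2 * a.val, by have := a.isLt; rw [pow_succ]; omega⟩ +
        F ⟨2 * a.val + 1, by have := a.isLt; rw [pow_succ]; omega⟩) := by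
  rw [← Equiv.sum_comp (finProdFinEquiv.trans (finCongr (pow_succ 2 m).symm)) F,
    Fintype.sum_prod_type]
  refine Finset.sum_congr rfl fun a _ => ?_
  rw [Fin.sum_univ_two]
  congr 2 <;> ext <;> simp [finProdFinEquiv, add_comm]

theorem bitrev_succ (m i : ℕ) : bitrev (m + 1) i = i % 2 * 2 ^ m + bitrev m (i / 2) := by
  unfold bitrev
  rw [Finset.sum_range_succ', add_comm]
  congr 1
  · simp
  · refine Finset.sum_congr rfl fun k _ => ?_
    rw [pow_succ', ← Nat.div_div_eq_div_mul]
    congr 2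
    omega

theorem bitrev_lt (m i : ℕ) : bitrev m i < 2 ^ m := by
  induction m generalizing i with
  | zero => simp [bitrev]
  | succ m ih =>
    have := ih (i / 2)
    have h2 : i % 2 < 2 := Nat.mod_lt _ (by norm_num)
    rw [bitrev_succ, pow_succ]
    nlinarith

theorem Gmat_apply (m : ℕ) (i j : Fin (2 ^ m)) :
    Gmat m i j = kronPow m ⟨bitrev m i, bitrev_lt m i⟩ j := by
  rw [Gmat, Matrix.mul_apply, Finset.sum_eq_single ⟨bitrev m i, bitrev_lt m i⟩]
  · simp [Bmat]
  · intro k _ hk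
    have : (k : ℕ) ≠ bitrev m i := fun h => hk (Fin.ext h)
    simp [Bmat, this]
  · simp

theorem add_mul_two_pow_div_mod {m k : ℕ} (hk : k < m) (e x : ℕ) :
    (e * 2 ^ m + x) / 2 ^ k % 2 = x / 2 ^ k % 2 := by
  obtain ⟨d, rfl⟩ := Nat.exists_eq_add_of_lt hk
  have h : e * 2 ^ (k + d + 1) + x = x + 2 ^ k * (2 * (e * 2 ^ d)) := by ring
  rw [h, Nat.add_mul_div_left _ _ (by positivity), Nat.add_mul_mod_self_left]

theorem kronPow_succ_apply (m : ℕ) (e f : Fin 2) (x y : Fin (2 ^ m)) (hx hy) :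
    kronPow (m + 1) ⟨e.val * 2 ^ m + x.val, hx⟩ ⟨f.val * 2 ^ m + y.val, hy⟩ =
      kronPow m x y * K2 e f := by
  have top : ∀ (g : Fin 2) (z : Fin (2 ^ m)), (g.val * 2 ^ m + z.val) / 2 ^ m % 2 = g.val := by
    intro g z
    rw [mul_comm, Nat.mul_add_div (by positivity), Nat.div_eq_of_lt z.isLt, add_zero,
      Nat.mod_eq_of_lt g.isLt]
  simp only [kronPow, Matrix.of_apply, Finset.prod_range_succ, top]
  congr 1
  refine Finset.prod_congr rfl fun k hk => ?_
  simp only [add_mul_two_pow_div_mod (Finset.mem_range.mp hk)]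

theorem Gmat_succ_apply (m : ℕ) (e f : Fin 2) (a y : Fin (2 ^ m)) (hx hy) :
    Gmat (m + 1) ⟨2 * a.val + e.val, hx⟩ ⟨f.val * 2 ^ m + y.val, hy⟩ =
      Gmat m a y * K2 e f := by
  have hlt : e.val * 2 ^ m + bitrev m a < 2 ^ (m + 1) := by
    have := bitrev_lt m a
    have := e.isLt
    rw [pow_succ]
    nlinarith
  rw [Gmat_apply, Gmat_apply, ← kronPow_succ_apply m e f _ y hlt hy]
  congr 1
  ext
  have h1 : (2 * a.val + e.val) % 2 = e.val := by omega
  have h2 : (2 * a.val + e.val) / 2 = a.val := by omega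
  simp only [bitrev_succ, h1, h2]

/-- Even-index entries of a vector of length `2^(m+1)`. -/
def evens {m : ℕ} (u : Fin (2 ^ (m + 1)) → ZMod 2) : Fin (2 ^ m) → ZMod 2 :=
  fun a => u ⟨2 * a.val, by have := a.isLt; rw [pow_succ]; omega⟩

/-- Odd-index entries of a vector of length `2^(m+1)`. -/
def odds {m : ℕ} (u : Fin (2 ^ (m + 1)) → ZMod 2) : Fin (2 ^ m) → ZMod 2 :=
  fun a => u ⟨2 * a.val + 1, by have := a.isLt; rw [pow_succ]; omega⟩

theorem vecMul_Gmat_succ (m : ℕ) (u : Fin (2 ^ (m + 1)) → ZMod 2) :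
    u ᵥ* Gmat (m + 1) =
      concatPow ((evens u + odds u) ᵥ* Gmat m) (odds u ᵥ* Gmat m) := by
  ext j
  have hj := j.isLt.trans_eq (pow_succ 2 m)
  simp only [Matrix.vecMul, dotProduct, concatPow, sum_fin_two_pow_succ]
  split_ifs with h
  · refine Finset.sum_congr rfl fun a _ => ?_
    have h0 := Gmat_succ_apply m 0 0 a ⟨j, h⟩
    have h1 := Gmat_succ_apply m 1 0 a ⟨j, h⟩
    simp only [Fin.val_zero, Fin.val_one, zero_mul, zero_add, add_zero, Fin.eta] at h0 h1
    rw [h0, h1]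
    · simp [K2, evens, odds, add_mul]
    all_goals omega
  · refine Finset.sum_congr rfl fun a _ => ?_
    have h0 := Gmat_succ_apply m 0 1 a ⟨j - 2 ^ m, by omega⟩
    have h1 := Gmat_succ_apply m 1 1 a ⟨j - 2 ^ m, by omega⟩
    have e : 2 ^ m + (j.val - 2 ^ m) = j.val := by omega
    simp only [Fin.val_zero, Fin.val_one, one_mul, add_zero, e, Fin.eta] at h0 h1
    rw [h0, h1]
    · simp [K2, odds]
    all_goals omega

theorem mem_polarCoset {m i : ℕ} {p : Fin i → ZMod 2} {b : ZMod 2} {c : Fin (2 ^ m) → ZMod 2} :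
    c ∈ polarCoset m i p b ↔ ∃ u : Fin (2 ^ m) → ZMod 2,
      (∀ (j : Fin (2 ^ m)) (h : j.val < i), u j = p ⟨j, h⟩) ∧
      (∀ j : Fin (2 ^ m), j.val = i → u j = b) ∧ c = u ᵥ* Gmat m := by
  constructor
  · rintro ⟨s, rfl⟩
    refine ⟨_, fun j h => ?_, fun j h => ?_, rfl⟩ <;> simp [assemble, h]
  · rintro ⟨u, hp, hb, rfl⟩
    refine ⟨fun k => u ⟨k.val + i + 1, by have := k.isLt; omega⟩, ?_⟩
    congr 1
    ext j
    unfold assemble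
    split_ifs with h h2
    · exact hp j h
    · exact hb j h2
    · congr 1
      ext
      simp only
      omega

theorem polarCoset_succ_odd (m i : ℕ) (p : Fin (2 * i + 1) → ZMod 2) (b : ZMod 2)
    (c : Fin (2 ^ (m + 1)) → ZMod 2) :
    c ∈ polarCoset (m + 1) (2 * i + 1) p b ↔
      ∃ x ∈ polarCoset m i (evPart (initPart p) + odPart (initPart p)) (p ⟨2 * i, by omega⟩ + b),
        ∃ y ∈ polarCoset m i (odPart (initPart p)) b, concatPow x y = c := by
  constructor
  · intro hc
    obtain ⟨u, hp, hb, rfl⟩ := mem_polarCoset.mp hc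
    refine ⟨_, mem_polarCoset.mpr ⟨evens u + odds u, fun j h => ?_, fun j h => ?_, rfl⟩, _,
      mem_polarCoset.mpr ⟨odds u, fun j h => ?_, fun j h => ?_, rfl⟩, (vecMul_Gmat_succ m u).symm⟩
    · simp only [Pi.add_apply, evens, odds, evPart, odPart, initPart]
      rw [hp _ (by simp only; omega), hp _ (by simp only; omega)]
    · subst h
      simp only [Pi.add_apply, evens, odds]
      rw [hp _ (by simp), hb _ rfl]
    · exact hp _ (by simp only; omega)
    · exact hb _ (by simp only; omega)
  · rintro ⟨x, hx, y, hy, rfl⟩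
    obtain ⟨v, hvp, hvb, rfl⟩ := mem_polarCoset.mp hx
    obtain ⟨w, hwp, hwb, rfl⟩ := mem_polarCoset.mp hy
    have half : ∀ j : Fin (2 ^ (m + 1)), j.val / 2 < 2 ^ m := by
      intro j
      have := j.isLt.trans_eq (pow_succ 2 m)
      omega
    let u : Fin (2 ^ (m + 1)) → ZMod 2 := fun j =>
      if j.val % 2 = 0 then v ⟨j.val / 2, half j⟩ + w ⟨j.val / 2, half j⟩
      else w ⟨j.val / 2, half j⟩
    have hodd : odds u = w := by
      ext a
      have : (2 * a.val + 1) / 2 = a.val := by omega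
      simp [odds, u, this, Nat.add_mod]
    have hev : evens u + odds u = v := by
      rw [hodd]
      ext a
      simp [evens, u, add_assoc, CharTwo.add_self_eq_zero]
    refine mem_polarCoset.mpr ⟨u, fun j h => ?_, fun j h => ?_, ?_⟩
    · rcases Nat.lt_or_ge j.val (2 * i) with h' | h'
      · have hw := hwp ⟨j.val / 2, half j⟩ (by simp only; omega)
        have hv := hvp ⟨j.val / 2, half j⟩ (by simp only; omega)
        simp only [Pi.add_apply, evPart, odPart, initPart] at hw hv
        rcases Nat.mod_two_eq_zero_or_one j.val with h2 | h2
        · have e : 2 * (j.val / 2) = j.val := by omega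
          simp only [u, h2, if_true, hv, hw, add_assoc, CharTwo.add_self_eq_zero, add_zero, e]
        · have e : 2 * (j.val / 2) + 1 = j.val := by omega
          simp only [u, h2, one_ne_zero, if_false, hw, e]
      · have e : j.val = 2 * i := by omega
        have hw := hwb ⟨j.val / 2, half j⟩ (by simp only; omega)
        have hv := hvb ⟨j.val / 2, half j⟩ (by simp only; omega)
        have h2 : j.val % 2 = 0 := by omega
        simp only [u, h2, if_true, hv, hw, add_assoc, CharTwo.add_self_eq_zero, add_zero]
        congr 1
        exact Fin.ext e.symm
    · have h2 : j.val % 2 = 1 := by omega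
      simp only [u, h2, one_ne_zero, if_false]
      exact hwb _ (by simp only; omega)
    · rw [vecMul_Gmat_succ, hev, hodd]

theorem concatPow_left {m : ℕ} (x y : Fin (2 ^ m) → ZMod 2) (k : Fin (2 ^ m)) (h) :
    concatPow x y ⟨k.val, h⟩ = x k := by
  simp [concatPow]

theorem concatPow_right {m : ℕ} (x y : Fin (2 ^ m) → ZMod 2) (k : Fin (2 ^ m)) (h) :
    concatPow x y ⟨2 ^ m + k.val, h⟩ = y k := by
  simp [concatPow]

theorem concatPow_inj {m : ℕ} {x y x' y' : Fin (2 ^ m) → ZMod 2}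
    (h : concatPow x y = concatPow x' y') : x = x' ∧ y = y' := by
  have e : 2 ^ (m + 1) = 2 ^ m * 2 := pow_succ 2 m
  constructor <;> ext k
  · have hk := congrFun h ⟨k.val, by omega⟩
    rwa [concatPow_left, concatPow_left] at hk
  · have hk := congrFun h ⟨2 ^ m + k.val, by omega⟩
    rwa [concatPow_right, concatPow_right] at hk

theorem hammingNorm_concatPow {m : ℕ} (x y : Fin (2 ^ m) → ZMod 2) :
    hammingNorm (concatPow x y) = hammingNorm x + hammingNorm y := by
  have e : 2 ^ m + 2 ^ m = 2 ^ (m + 1) := by rw [pow_succ, mul_two]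
  simp only [hammingNorm, Finset.card_filter]
  rw [← Equiv.sum_comp (finCongr e), Fin.sum_univ_add]
  congr 1 <;> refine Finset.sum_congr rfl fun k _ => ?_
  · exact congrArg (fun z => if z ≠ 0 then 1 else 0) (concatPow_left x y k _)
  · exact congrArg (fun z => if z ≠ 0 then 1 else 0) (concatPow_right x y k _)

/-- The recursion for weight enumerating functions at odd indices:
`A_{2n}^{(2i+1)}(u_{2i}, u_{2i+1})(X) =
  A_n^{(i)}(u_{2i-1,even} ⊕ u_{2i-1,odd}, u_{2i} ⊕ u_{2i+1})(X) ·
  A_n^{(i)}(u_{2i-1,odd}, u_{2i+1})(X)`, where `u_{2i-1}` consists of the first `2i`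
entries of the prefix `u_{2i}`, whose last entry is `p ⟨2i, _⟩`. -/
theorem cosetWEF_odd_rec (m i : ℕ) (hi : i < 2 ^ m)
    (p : Fin (2 * i + 1) → ZMod 2) (b : ZMod 2) :
    cosetWEF (m + 1) (2 * i + 1) p b =
      cosetWEF m i (evPart (initPart p) + odPart (initPart p)) (p ⟨2 * i, by omega⟩ + b) *
        cosetWEF m i (odPart (initPart p)) b := by
  classical
  unfold cosetWEF
  rw [Finset.sum_mul_sum, ← Finset.sum_product']
  symm
  refine Finset.sum_bij (fun z _ => concatPow z.1 z.2) ?_ ?_ ?_ ?_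
  · rintro ⟨x, y⟩ h
    simp only [Finset.mem_product, Set.Finite.mem_toFinset] at h ⊢
    exact (polarCoset_succ_odd m i p b _).mpr ⟨x, h.1, y, h.2, rfl⟩
  · rintro ⟨x, y⟩ _ ⟨x', y'⟩ _ h
    obtain ⟨rfl, rfl⟩ := concatPow_inj h
    rfl
  · intro c hc
    obtain ⟨x, hx, y, hy, rfl⟩ :=
      (polarCoset_succ_odd m i p b c).mp ((Set.Finite.mem_toFinset _).mp hc)
    exact ⟨(x, y), by simpa using ⟨hx, hy⟩, rfl⟩
  · rintro ⟨x, y⟩ _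
    rw [hammingNorm_concatPow, pow_add]
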